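/- The set {M(l,i) : 1 ≤ l ≤ n−1, i ∈ ℤ_{mn}} ∪ {Z(λ_{i′j′}) : (i′,j′) ∈ I_0} is a representative set of the isomorphism classes of finite dimensional simple left H_{mn}(ξ)-modules; that is, every finite dimensional simple H_{mn}(ξ)-module is isomorphic to exactly one module in this set. -/

import Mathlib

noncomputable section

namespace Radford

variable (𝕜 : Type) [Field 𝕜]

/-- The q-integer `(k)_q = 1 + q + ⋯ + q^(k-1)`. -/
def qInt (q : 𝕜) (k : ℕ) : 𝕜 := ∑ j ∈ Finset.range k, q ^ j

/-- The q-factorial `(k)!_q = (1)_q (2)_q ⋯ (k)_q`. -/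
def qFact (q : 𝕜) : ℕ → 𝕜
  | 0 => 1
  | k + 1 => qFact q k * qInt 𝕜 q (k + 1)

variable (m n : ℕ) (ξ : 𝕜)

/-- Generators of the free algebra: 0 ↦ a, 1 ↦ b, 2 ↦ c, 3 ↦ d. -/
def fgen (k : Fin 4) : FreeAlgebra 𝕜 (Fin 4) := FreeAlgebra.ι 𝕜 k

local notation "fa" => fgen 𝕜 0
local notation "fb" => fgen 𝕜 1
local notation "fc" => fgen 𝕜 2
local notation "fd" => fgen 𝕜 3

/-- The defining relations of the Drinfeld double `H_{mn}(ξ) = D(R_{mn}(q))`, where `q = ξ^m`. -/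
inductive HRel : FreeAlgebra 𝕜 (Fin 4) → FreeAlgebra 𝕜 (Fin 4) → Prop
  | aPow : HRel (fa ^ n) (fb ^ n - 1)
  | bPow : HRel (fb ^ (m * n)) 1
  | cPow : HRel (fc ^ (m * n)) 1
  | dPow : HRel (fd ^ n) 0
  | ab : HRel (fa * fb) (ξ ^ m • (fb * fa))
  | dc : HRel (fd * fc) (ξ • (fc * fd))
  | bc : HRel (fb * fc) (fc * fb)
  | bd : HRel (fb * fd) (ξ ^ m • (fd * fb))
  | ad : HRel (fa * fd - fd * fa) (fb - fc ^ m)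
  | ac : HRel (fa * fc)
      (ξ⁻¹ • (fc * fa) +
        ((ξ⁻¹ - ξ ^ (n - 1)) / qFact 𝕜 (ξ ^ m) (n - 1)) •
          ((fc ^ (m + 1) - ξ ^ m • (fb * fc)) * fd ^ (n - 1)))

/-- The Drinfeld double `H_{mn}(ξ)` of the Radford Hopf algebra `R_{mn}(q)`, presented by
generators `a, b, c, d` and the above relations. -/
def H := RingQuot (HRel 𝕜 m n ξ)

instance : Ring (H 𝕜 m n ξ) := inferInstanceAs (Ring (RingQuot (HRel 𝕜 m n ξ)))

instance : Algebra 𝕜 (H 𝕜 m n ξ) := inferInstanceAs (Algebra 𝕜 (RingQuot (HRel 𝕜 m n ξ)))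

/-- The generators `a, b, c, d` of `H_{mn}(ξ)` (indexed by 0,1,2,3). -/
def gen (k : Fin 4) : H 𝕜 m n ξ := RingQuot.mkAlgHom 𝕜 (HRel 𝕜 m n ξ) (fgen 𝕜 k)

local notation "ha" => gen 𝕜 m n ξ 0
local notation "hb" => gen 𝕜 m n ξ 1
local notation "hc" => gen 𝕜 m n ξ 2
local notation "hd" => gen 𝕜 m n ξ 3

/-- The Jacobson radical `J` of `H_{mn}(ξ)`. -/
def jrad : Ideal (H 𝕜 m n ξ) := Ideal.jacobson ⊥

/-- The scalars `α_k(l,i)`;  `alph l i k` is `α_k(l,i)`, where `q = ξ^m`. -/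
def alph (l : ℕ) (i : ℤ) (k : ℕ) : 𝕜 :=
  if k = n then ((ξ ^ m) ^ (i + (l : ℤ)) - (ξ ^ m) ^ i) / qFact 𝕜 (ξ ^ m) (n - 1)
  else qInt 𝕜 (ξ ^ m) k * ((ξ ^ m) ^ i - (ξ ^ m) ^ (i + (l : ℤ) - (k : ℤ)))

/-- The scalars `γ_k(l,i)`;  `gam l i k` is `γ_k(l,i)`, where `q = ξ^m`. -/
def gam (l : ℕ) (i : ℤ) (k : ℕ) : 𝕜 :=
  if k = n then ((ξ ^ m) ^ i - (ξ ^ m) ^ (i + (l : ℤ))) / qFact 𝕜 (ξ ^ m) (n - 1)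
  else qInt 𝕜 (ξ ^ m) k * ((ξ ^ m) ^ (i + (l : ℤ)) - (ξ ^ m) ^ (i - (k : ℤ)))

section ModuleH

variable {W : Type} [AddCommGroup W] [Module (H 𝕜 m n ξ) W]

variable (W) in
/-- The socle of an `H`-module: the sum of all simple submodules. -/
def socle : Submodule (H 𝕜 m n ξ) W :=
  sSup {N : Submodule (H 𝕜 m n ξ) W | IsSimpleModule (H 𝕜 m n ξ) N}

variable (W) in
/-- The submodule `J•W`, the radical of `W`. -/
def radM : Submodule (H 𝕜 m n ξ) W :=
  Submodule.span (H 𝕜 m n ξ) {x | ∃ r ∈ jrad 𝕜 m n ξ, ∃ w : W, x = r • w}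

variable (W) in
/-- The submodule `J²•W`. -/
def rad2M : Submodule (H 𝕜 m n ξ) W :=
  Submodule.span (H 𝕜 m n ξ)
    {x | ∃ r ∈ jrad 𝕜 m n ξ, ∃ s ∈ jrad 𝕜 m n ξ, ∃ w : W, x = r • s • w}

variable (W) in
/-- The submodule `J³•W`. -/
def rad3M : Submodule (H 𝕜 m n ξ) W :=
  Submodule.span (H 𝕜 m n ξ)
    {x | ∃ r ∈ jrad 𝕜 m n ξ, ∃ s ∈ jrad 𝕜 m n ξ, ∃ t ∈ jrad 𝕜 m n ξ, ∃ w : W, x = r • s • t • w}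

variable (W) in
/-- `lengthIs c W` : the `H`-module `W` has a composition series of length `c`
(hence, by Jordan–Hölder, has composition length `c`). -/
def lengthIs (c : ℕ) : Prop :=
  ∃ s : CompositionSeries (Submodule (H 𝕜 m n ξ) W), s.head = ⊥ ∧ s.last = ⊤ ∧ s.length = c

variable (W) in
/-- An `H`-module is indecomposable if it is nonzero and is not the direct sum of two
nonzero submodules. -/
def Indec : Prop :=
  Nontrivial W ∧ ∀ N₁ N₂ : Submodule (H 𝕜 m n ξ) W, IsCompl N₁ N₂ → N₁ = ⊥ ∨ N₂ = ⊥

variable (W) in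
/-- `W` has Loewy length 2: `J•W ≠ 0` and `J²•W = 0`. -/
def LoewyLen2 : Prop := radM 𝕜 m n ξ W ≠ ⊥ ∧ rad2M 𝕜 m n ξ W = ⊥

variable (W) in
/-- `W` is of `(s,t)`-type: it has Loewy length `2`, its socle has composition length `t`,
and `W/soc W` has composition length `s`. -/
def IsType (s t : ℕ) : Prop :=
  LoewyLen2 𝕜 m n ξ W ∧ lengthIs 𝕜 m n ξ (socle 𝕜 m n ξ W) t ∧
    lengthIs 𝕜 m n ξ (W ⧸ socle 𝕜 m n ξ W) s

end ModuleH

section ModuleK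

variable {V : Type} [AddCommGroup V] [Module 𝕜 V] [Module (H 𝕜 m n ξ) V]
  [IsScalarTower 𝕜 (H 𝕜 m n ξ) V]

variable (V) in
/-- `V^d = {v ∈ V | d•v = 0}`, as a `𝕜`-subspace. -/
def dKer : Submodule 𝕜 V where
  carrier := {v | hd • v = 0}
  add_mem' := by
    intro x y hx hy
    simp only [Set.mem_setOf_eq] at *
    rw [smul_add, hx, hy, add_zero]
  zero_mem' := smul_zero _
  smul_mem' := by
    intro r v hv
    simp only [Set.mem_setOf_eq] at *
    rw [smul_comm, hv, smul_zero]

variable (V) in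
/-- `V_{(i)} = {v ∈ V | c•v = ξ^i v}`, as a `𝕜`-subspace. -/
def eigsp (i : ℤ) : Submodule 𝕜 V where
  carrier := {v | hc • v = ξ ^ i • v}
  add_mem' := by
    intro x y hx hy
    simp only [Set.mem_setOf_eq] at *
    rw [smul_add, hx, hy, smul_add]
  zero_mem' := by simp
  smul_mem' := by
    intro r v hv
    simp only [Set.mem_setOf_eq] at *
    rw [smul_comm, hv, smul_comm]

/-- `V`, equipped with the family `mv : Fin l → V`, realizes the simple module `M(l,i)`:
`mv` is a basis of `V` and the generators act by the defining formulas of `M(l,i)`. -/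
def IsMrep (l : ℕ) (i : ℤ) (mv : Fin l → V) : Prop :=
  LinearIndependent 𝕜 mv ∧ Submodule.span 𝕜 (Set.range mv) = ⊤ ∧
  (∀ (j : ℕ) (hj : j + 1 < l),
    ha • mv ⟨j, by omega⟩ = alph 𝕜 m n ξ l i (j + 1) • mv ⟨j + 1, hj⟩) ∧
  (∀ (j : ℕ) (hj : j < l), j + 1 = l → ha • mv ⟨j, hj⟩ = 0) ∧
  (∀ j : Fin l, hb • mv j = ((ξ ^ m) ^ (i + (l : ℤ) - ((j : ℕ) + 1 : ℤ)) : 𝕜) • mv j) ∧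
  (∀ j : Fin l, hc • mv j = (ξ ^ (i + (j : ℕ) : ℤ) : 𝕜) • mv j) ∧
  (∀ (j : ℕ) (hj : j + 1 < l), hd • mv ⟨j + 1, hj⟩ = mv ⟨j, by omega⟩) ∧
  (∀ hl : 0 < l, hd • mv ⟨0, hl⟩ = 0)

/-- `V` realizes the induced module `Z(λ_{ij})`: there is a cyclic vector `z` with
`d•z = 0`, `b•z = ξ^j z`, `c•z = ξ^i z` such that `(a^k • z)_{0 ≤ k ≤ n-1}` is a basis. -/
def IsZrep (i j : ℤ) (V : Type) [AddCommGroup V] [Module 𝕜 V] [Module (H 𝕜 m n ξ) V]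
    [IsScalarTower 𝕜 (H 𝕜 m n ξ) V] : Prop :=
  ∃ z : V, hd • z = 0 ∧ hb • z = (ξ ^ j : 𝕜) • z ∧ hc • z = (ξ ^ i : 𝕜) • z ∧
    LinearIndependent 𝕜 (fun k : Fin n => (ha ^ (k : ℕ)) • z) ∧
    Submodule.span 𝕜 (Set.range fun k : Fin n => (ha ^ (k : ℕ)) • z) = ⊤

/-- `V`, equipped with the families `v u : Fin n → V`, realizes the projective module `P(l,i)`
with its standard basis. -/
def IsPrep (l : ℕ) (hl1 : 1 ≤ l) (hl2 : l < n) (i : ℤ) (v u : Fin n → V) : Prop :=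
  LinearIndependent 𝕜 (Sum.elim v u) ∧
  Submodule.span 𝕜 (Set.range v ∪ Set.range u) = ⊤ ∧
  (∀ (j : ℕ) (hj : j + l + 2 ≤ n),
    ha • v ⟨j, by omega⟩ = gam 𝕜 m n ξ l i (j + 1) • v ⟨j + 1, by omega⟩) ∧
  (∀ (j : ℕ) (hj : j + 1 < n), n ≤ j + 1 + l →
    ha • v ⟨j, by omega⟩ =
      gam 𝕜 m n ξ l i (j + 1) • v ⟨j + 1, hj⟩ + u ⟨j + 1 + l - n, by omega⟩) ∧
  (ha • v ⟨n - 1, by omega⟩ = gam 𝕜 m n ξ l i n • v ⟨0, by omega⟩ + u ⟨l, by omega⟩) ∧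
  (∀ (j : ℕ) (hj : j + 1 < n),
    ha • u ⟨j, by omega⟩ = alph 𝕜 m n ξ l i (j + 1) • u ⟨j + 1, hj⟩) ∧
  (ha • u ⟨n - 1, by omega⟩ = alph 𝕜 m n ξ l i n • u ⟨0, by omega⟩) ∧
  (∀ j : Fin n, hb • v j = ((ξ ^ m) ^ (i + (n : ℤ) - ((j : ℕ) + 1 : ℤ)) : 𝕜) • v j) ∧
  (∀ j : Fin n, hb • u j = ((ξ ^ m) ^ (i + (l : ℤ) - ((j : ℕ) + 1 : ℤ)) : 𝕜) • u j) ∧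
  (∀ j : Fin n, hc • v j = (ξ ^ (i - ((n : ℤ) - (l : ℤ)) + (j : ℕ) : ℤ) : 𝕜) • v j) ∧
  (∀ j : Fin n, hc • u j = (ξ ^ (i + (j : ℕ) : ℤ) : 𝕜) • u j) ∧
  (hd • v ⟨0, by omega⟩ = 0) ∧
  (∀ (j : ℕ) (hj : j + 1 < n), hd • v ⟨j + 1, hj⟩ = v ⟨j, by omega⟩) ∧
  (hd • u ⟨0, by omega⟩ = 0) ∧
  (∀ (j : ℕ) (hj : j + 1 < n), hd • u ⟨j + 1, hj⟩ = u ⟨j, by omega⟩)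

/-- `V`, equipped with the basis `e : Fin n → V`, realizes the module `T_1(l,i)`. -/
def IsT1rep (l : ℕ) (hl1 : 1 ≤ l) (hl2 : l < n) (i : ℤ) (e : Fin n → V) : Prop :=
  LinearIndependent 𝕜 e ∧ Submodule.span 𝕜 (Set.range e) = ⊤ ∧
  (∀ (j : ℕ) (hj : j + 1 < n),
    ha • e ⟨j, by omega⟩ = alph 𝕜 m n ξ l i (j + 1) • e ⟨j + 1, hj⟩) ∧
  (ha • e ⟨n - 1, by omega⟩ = alph 𝕜 m n ξ l i n • e ⟨0, by omega⟩) ∧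
  (∀ j : Fin n, hb • e j = ((ξ ^ m) ^ (i + (l : ℤ) - ((j : ℕ) + 1 : ℤ)) : 𝕜) • e j) ∧
  (∀ j : Fin n, hc • e j = (ξ ^ (i + (j : ℕ) : ℤ) : 𝕜) • e j) ∧
  (hd • e ⟨0, by omega⟩ = 0) ∧
  (∀ (j : ℕ) (hj : j + 1 < n), hd • e ⟨j + 1, hj⟩ = e ⟨j, by omega⟩)

/-- `V`, equipped with the basis `e : Fin n → V`, realizes the module `T̄_1(l,i)`. -/
def IsT1barrep (l : ℕ) (hl1 : 1 ≤ l) (hl2 : l < n) (i : ℤ) (e : Fin n → V) : Prop :=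
  LinearIndependent 𝕜 e ∧ Submodule.span 𝕜 (Set.range e) = ⊤ ∧
  (∀ (j : ℕ) (hj : j + 1 < n - l),
    ha • e ⟨j, by omega⟩ = alph 𝕜 m n ξ (n - l) (i + l - n) (j + 1) • e ⟨j + 1, by omega⟩) ∧
  (ha • e ⟨n - l - 1, by omega⟩ = e ⟨n - l, by omega⟩) ∧
  (∀ (k : ℕ) (hk : k + 1 < l),
    ha • e ⟨n - l + k, by omega⟩ = alph 𝕜 m n ξ l i (k + 1) • e ⟨n - l + k + 1, by omega⟩) ∧
  (ha • e ⟨n - 1, by omega⟩ = 0) ∧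
  (∀ j : Fin n, hb • e j = ((ξ ^ m) ^ (i - ((j : ℕ) + 1 : ℤ)) : 𝕜) • e j) ∧
  (∀ j : Fin n, hc • e j = (ξ ^ (i + (l : ℤ) - (n : ℤ) + (j : ℕ) : ℤ) : 𝕜) • e j) ∧
  (hd • e ⟨0, by omega⟩ = 0) ∧
  (∀ (j : ℕ) (hj : j + 1 < n - l), hd • e ⟨j + 1, by omega⟩ = e ⟨j, by omega⟩) ∧
  (hd • e ⟨n - l, by omega⟩ = 0) ∧
  (∀ (k : ℕ) (hk : k + 1 < l), hd • e ⟨n - l + k + 1, by omega⟩ = e ⟨n - l + k, by omega⟩)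

end ModuleK

section Matrices

/-- The nilpotent Jordan-type matrix `D_s` with `1` on the superdiagonal. -/
def Dmat (s : ℕ) : Matrix (Fin s) (Fin s) 𝕜 :=
  fun r c => if (r : ℕ) + 1 = (c : ℕ) then 1 else 0

/-- The matrix `X_{l,i}` : subdiagonal entries `γ_k(l,i)`, `(1,n)`-entry `γ_n(l,i)`. -/
def Xmat (l : ℕ) (i : ℤ) : Matrix (Fin n) (Fin n) 𝕜 := fun r c =>
  if (r : ℕ) = (c : ℕ) + 1 then gam 𝕜 m n ξ l i ((c : ℕ) + 1)
  else if (r : ℕ) = 0 ∧ (c : ℕ) = n - 1 then gam 𝕜 m n ξ l i n else 0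

/-- The matrix `Z_{l,i}` : subdiagonal entries `α_k(l,i)`, `(1,n)`-entry `α_n(l,i)`. -/
def Zmat (l : ℕ) (i : ℤ) : Matrix (Fin n) (Fin n) 𝕜 := fun r c =>
  if (r : ℕ) = (c : ℕ) + 1 then alph 𝕜 m n ξ l i ((c : ℕ) + 1)
  else if (r : ℕ) = 0 ∧ (c : ℕ) = n - 1 then alph 𝕜 m n ξ l i n else 0

/-- The block matrix `A(l,i) = [[X_{l,i}, 0], [D_n^{n-l-1}, Z_{l,i}]]`. -/
def Amat (l : ℕ) (i : ℤ) : Matrix (Fin n ⊕ Fin n) (Fin n ⊕ Fin n) 𝕜 :=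
  Matrix.fromBlocks (Xmat 𝕜 m n ξ l i) 0 (Dmat 𝕜 n ^ (n - l - 1)) (Zmat 𝕜 m n ξ l i)

/-- The diagonal matrix `B(l,i)`. -/
def Bmat (l : ℕ) (i : ℤ) : Matrix (Fin n ⊕ Fin n) (Fin n ⊕ Fin n) 𝕜 :=
  Matrix.fromBlocks
    (Matrix.diagonal fun j : Fin n => (ξ ^ m) ^ (i - ((j : ℕ) + 1 : ℤ))) 0 0
    (Matrix.diagonal fun j : Fin n => (ξ ^ m) ^ (i + (l : ℤ) - ((j : ℕ) + 1 : ℤ)))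

/-- The diagonal matrix `C(l,i)`. -/
def Cmat (l : ℕ) (i : ℤ) : Matrix (Fin n ⊕ Fin n) (Fin n ⊕ Fin n) 𝕜 :=
  Matrix.fromBlocks
    (Matrix.diagonal fun j : Fin n => ξ ^ (i + (l : ℤ) - (n : ℤ) + (j : ℕ))) 0 0
    (Matrix.diagonal fun j : Fin n => ξ ^ (i + (j : ℕ) : ℤ))

/-- The block matrix `D = diag(D_n, D_n)`. -/
def Dbig : Matrix (Fin n ⊕ Fin n) (Fin n ⊕ Fin n) 𝕜 :=
  Matrix.fromBlocks (Dmat 𝕜 n) 0 0 (Dmat 𝕜 n)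

end Matrices


section HighestWeight

variable {𝕜 m n ξ}

theorem mkAlgHom_rel_eq {x y : FreeAlgebra 𝕜 (Fin 4)} (h : HRel 𝕜 m n ξ x y) :
    RingQuot.mkAlgHom 𝕜 (HRel 𝕜 m n ξ) x = RingQuot.mkAlgHom 𝕜 (HRel 𝕜 m n ξ) y :=
  RingQuot.mkAlgHom_rel 𝕜 h

theorem gen_a_pow : (ha ^ n : H 𝕜 m n ξ) = hb ^ n - 1 := by
  have h := mkAlgHom_rel_eq (HRel.aPow (𝕜 := 𝕜) (m := m) (n := n) (ξ := ξ))
  rwa [map_sub, map_pow, map_pow, map_one] at h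

theorem gen_b_pow : (hb ^ (m * n) : H 𝕜 m n ξ) = 1 := by
  have h := mkAlgHom_rel_eq (HRel.bPow (𝕜 := 𝕜) (m := m) (n := n) (ξ := ξ))
  rwa [map_pow, map_one] at h

theorem gen_c_pow : (hc ^ (m * n) : H 𝕜 m n ξ) = 1 := by
  have h := mkAlgHom_rel_eq (HRel.cPow (𝕜 := 𝕜) (m := m) (n := n) (ξ := ξ))
  rwa [map_pow, map_one] at h

theorem gen_d_pow : (hd ^ n : H 𝕜 m n ξ) = 0 := by
  have h := mkAlgHom_rel_eq (HRel.dPow (𝕜 := 𝕜) (m := m) (n := n) (ξ := ξ))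
  rwa [map_pow, map_zero] at h

theorem gen_a_mul_b : (ha * hb : H 𝕜 m n ξ) = ξ ^ m • (hb * ha) := by
  have h := mkAlgHom_rel_eq (HRel.ab (𝕜 := 𝕜) (m := m) (n := n) (ξ := ξ))
  rwa [map_smul, map_mul, map_mul] at h

theorem gen_d_mul_c : (hd * hc : H 𝕜 m n ξ) = ξ • (hc * hd) := by
  have h := mkAlgHom_rel_eq (HRel.dc (𝕜 := 𝕜) (m := m) (n := n) (ξ := ξ))
  rwa [map_smul, map_mul, map_mul] at h

theorem gen_b_mul_c : (hb * hc : H 𝕜 m n ξ) = hc * hb := by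
  have h := mkAlgHom_rel_eq (HRel.bc (𝕜 := 𝕜) (m := m) (n := n) (ξ := ξ))
  rwa [map_mul, map_mul] at h

theorem gen_b_mul_d : (hb * hd : H 𝕜 m n ξ) = ξ ^ m • (hd * hb) := by
  have h := mkAlgHom_rel_eq (HRel.bd (𝕜 := 𝕜) (m := m) (n := n) (ξ := ξ))
  rwa [map_smul, map_mul, map_mul] at h

theorem gen_a_mul_d : (ha * hd - hd * ha : H 𝕜 m n ξ) = hb - hc ^ m := by
  have h := mkAlgHom_rel_eq (HRel.ad (𝕜 := 𝕜) (m := m) (n := n) (ξ := ξ))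
  rwa [map_sub, map_mul, map_mul, map_sub, map_pow] at h

theorem gen_a_mul_c : (ha * hc : H 𝕜 m n ξ) = ξ⁻¹ • (hc * ha) +
    ((ξ⁻¹ - ξ ^ (n - 1)) / qFact 𝕜 (ξ ^ m) (n - 1)) •
      ((hc ^ (m + 1) - ξ ^ m • (hb * hc)) * hd ^ (n - 1)) := by
  have h := mkAlgHom_rel_eq (HRel.ac (𝕜 := 𝕜) (m := m) (n := n) (ξ := ξ))
  simp only [map_sub, map_mul, map_add, map_smul, map_pow] at h
  exact h

theorem adjoin_range_gen : Algebra.adjoin 𝕜 (Set.range (gen 𝕜 m n ξ)) = ⊤ := by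
  have h : Set.range (gen 𝕜 m n ξ) =
      RingQuot.mkAlgHom 𝕜 (HRel 𝕜 m n ξ) '' Set.range (FreeAlgebra.ι 𝕜) := by
    rw [← Set.range_comp]; rfl
  rw [h]
  refine (AlgHom.map_adjoin (RingQuot.mkAlgHom 𝕜 (HRel 𝕜 m n ξ)) _).symm.trans ?_
  rw [FreeAlgebra.adjoin_range_ι, Algebra.map_top]
  exact (AlgHom.range_eq_top _).2 (RingQuot.mkAlgHom_surjective 𝕜 _)

theorem range_fin_eq_image_Ico {α : Type*} (f : ℕ → α) (t : ℕ) :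
    (Set.range fun k : Fin t => f k) = f '' Set.Ico 0 t := by
  ext x
  constructor
  · rintro ⟨k, rfl⟩; exact ⟨k, ⟨Nat.zero_le _, k.2⟩, rfl⟩
  · rintro ⟨k, ⟨_, hk⟩, rfl⟩; exact ⟨⟨k, hk⟩, rfl⟩

theorem eq_of_zpow_add_eq (hm : 0 < m) (hξ : IsPrimitiveRoot ξ (m * n)) (i : ℤ) {k l : ℕ}
    (hk : k < n) (hl : l < n) (h : ξ ^ (i + k) = ξ ^ (i + l)) : k = l := by
  have h0 : ξ ≠ 0 := hξ.ne_zero (Nat.mul_pos hm (by omega)).ne'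
  have hle : n ≤ m * n := Nat.le_mul_of_pos_left n hm
  rw [zpow_add₀ h0, zpow_add₀ h0, zpow_natCast, zpow_natCast] at h
  exact hξ.pow_inj (by omega) (by omega) (mul_left_cancel₀ (zpow_ne_zero _ h0) h)

variable {S : Type} [AddCommGroup S] [Module 𝕜 S] [Module (H 𝕜 m n ξ) S]

theorem IsMrep.finrank_eq {l : ℕ} {i : ℤ} {mv : Fin l → S} (h : IsMrep 𝕜 m n ξ l i mv) :
    Module.finrank 𝕜 S = l := by
  simpa using Module.finrank_eq_card_basis (Module.Basis.mk h.1 h.2.1.ge)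

variable [IsScalarTower 𝕜 (H 𝕜 m n ξ) S]

theorem smul_mem_of_gen_smul_mem (P : Submodule 𝕜 S)
    (hP : ∀ k, ∀ x ∈ P, gen 𝕜 m n ξ k • x ∈ P) (h : H 𝕜 m n ξ) :
    ∀ x ∈ P, h • x ∈ P := by
  have hh : h ∈ Algebra.adjoin 𝕜 (Set.range (gen 𝕜 m n ξ)) := by
    rw [adjoin_range_gen]; trivial
  induction hh using Algebra.adjoin_induction with
  | mem x hx => obtain ⟨k, rfl⟩ := hx; exact hP k
  | algebraMap r => intro x hx; rw [algebraMap_smul]; exact P.smul_mem r hx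
  | add x y _ _ hx hy => intro v hv; rw [add_smul]; exact P.add_mem (hx v hv) (hy v hv)
  | mul x y _ _ hx hy => intro v hv; rw [mul_smul]; exact hx _ (hy v hv)

theorem eq_top_of_gen_smul_mem [IsSimpleModule (H 𝕜 m n ξ) S] (P : Submodule 𝕜 S)
    (hP : ∀ k, ∀ x ∈ P, gen 𝕜 m n ξ k • x ∈ P) {v : S} (hv : v ∈ P) (hv0 : v ≠ 0) :
    P = ⊤ := by
  let Q : Submodule (H 𝕜 m n ξ) S :=
    { P with smul_mem' := fun h x hx => smul_mem_of_gen_smul_mem P hP h x hx }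
  have hQ : Q = ⊤ := (eq_bot_or_eq_top Q).resolve_left fun h =>
    hv0 ((Submodule.mem_bot _).1 (h ▸ (show v ∈ Q from hv)))
  refine eq_top_iff.2 fun x _ => ?_
  have : x ∈ Q := hQ ▸ Submodule.mem_top
  exact this

theorem pow_smul_of_smul_eq {h : H 𝕜 m n ξ} {γ : 𝕜} {x : S} (hx : h • x = γ • x) (k : ℕ) :
    h ^ k • x = γ ^ k • x := by
  induction k with
  | zero => simp
  | succ k ih => rw [pow_succ, mul_smul, hx, smul_comm, ih, smul_smul, pow_succ']

variable (m n ξ) in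
/-- `z` is a nonzero highest weight vector: `d•z = 0`, `b•z = β z`, `c•z = ξ^i z`. -/
structure IsHighestWeight (i : ℤ) (β : 𝕜) (z : S) : Prop where
  ne_zero : z ≠ 0
  d_smul : hd • z = 0
  b_smul : hb • z = β • z
  c_smul : hc • z = ξ ^ i • z

/-- The scalar `μ_k` with `d • a^k • z = μ_k a^(k-1) • z` for a highest weight vector `z`. -/
def lowerCoeff (q : 𝕜) (i : ℤ) (β : 𝕜) (k : ℕ) : 𝕜 :=
  qInt 𝕜 q k * (q ^ i - β * q ^ (1 - (k : ℤ)))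

theorem lowerCoeff_succ {q : 𝕜} (hq : q ≠ 0) (i : ℤ) (β : 𝕜) (k : ℕ) :
    lowerCoeff q i β (k + 1) =
      lowerCoeff q i β k - (q ^ (-(k : ℤ)) * β - q ^ (i + k)) := by
  have h1 : qInt 𝕜 q (k + 1) = qInt 𝕜 q k + q ^ k := by
    simp only [qInt, Finset.sum_range_succ]
  have h2 : qInt 𝕜 q k + q ^ k = q * qInt 𝕜 q k + 1 := by
    rw [← h1]; exact geom_sum_succ
  have e1 : q ^ (1 - ((k + 1 : ℕ) : ℤ)) = (q ^ k)⁻¹ := by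
    rw [show 1 - ((k + 1 : ℕ) : ℤ) = -(k : ℤ) by push_cast; ring, zpow_neg, zpow_natCast]
  have e2 : q ^ (1 - (k : ℤ)) = q * (q ^ k)⁻¹ := by
    rw [sub_eq_add_neg, zpow_add₀ hq, zpow_one, zpow_neg, zpow_natCast]
  rw [lowerCoeff, lowerCoeff, h1, e1, e2, zpow_add₀ hq, zpow_neg, zpow_natCast]
  linear_combination (-(β * (q ^ k)⁻¹)) * h2

theorem qInt_ne_zero {q : 𝕜} (hq : IsPrimitiveRoot q n) {k : ℕ} (hk0 : 0 < k) (hk : k < n) :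
    qInt 𝕜 q k ≠ 0 := by
  intro h
  have h1 : qInt 𝕜 q k * (q - 1) = q ^ k - 1 := geom_sum_mul q k
  rw [h, zero_mul] at h1
  exact hq.pow_ne_one_of_pos_of_lt hk0.ne' hk (sub_eq_zero.1 h1.symm)

theorem lowerCoeff_eq_zero_iff {q : 𝕜} (hq : IsPrimitiveRoot q n) (i : ℤ) (β : 𝕜) {k : ℕ}
    (hk0 : 0 < k) (hk : k < n) :
    lowerCoeff q i β k = 0 ↔ β = q ^ (i + (k : ℤ) - 1) := by
  have hq0 : q ≠ 0 := hq.ne_zero (by omega)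
  rw [lowerCoeff, mul_eq_zero, or_iff_right (qInt_ne_zero hq hk0 hk), sub_eq_zero,
    show i + (k : ℤ) - 1 = i - (1 - (k : ℤ)) by ring, zpow_sub₀ hq0 i,
    eq_div_iff (zpow_ne_zero _ hq0), eq_comm]

namespace IsHighestWeight

variable {i : ℤ} {β : 𝕜} {z : S}

theorem b_smul_pow (hz : IsHighestWeight m n ξ i β z) (hξ : ξ ≠ 0) (k : ℕ) :
    hb • ha ^ k • z = ((ξ ^ m) ^ (-(k : ℤ)) * β) • ha ^ k • z := by
  induction k with
  | zero => simpa using hz.b_smul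
  | succ k ih =>
    have hq : ξ ^ m ≠ 0 := pow_ne_zero _ hξ
    have h : (hb * ha : H 𝕜 m n ξ) = (ξ ^ m)⁻¹ • (ha * hb) := by
      rw [gen_a_mul_b, inv_smul_smul₀ hq]
    rw [pow_succ', mul_smul, ← mul_smul, h, smul_assoc, mul_smul, ih, smul_comm ha, smul_smul]
    congr 1
    rw [zpow_neg, zpow_neg, zpow_natCast, zpow_natCast, pow_succ (ξ ^ m), mul_inv_rev, mul_assoc]

theorem c_smul_pow_and_d_smul_pow (hz : IsHighestWeight m n ξ i β z) (hξ : ξ ≠ 0) (k : ℕ)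
    (hk : k < n) :
    hc • ha ^ k • z = ξ ^ (i + k) • ha ^ k • z ∧
    hd • ha ^ (k + 1) • z = lowerCoeff (ξ ^ m) i β (k + 1) • ha ^ k • z ∧
    hd ^ (k + 1) • ha ^ k • z = 0 := by
  have hq : ξ ^ m ≠ 0 := pow_ne_zero _ hξ
  have hda (x : S) : hd • ha • x = ha • hd • x - (hb • x - hc ^ m • x) := by
    rw [← sub_smul, ← gen_a_mul_d, sub_smul, mul_smul, mul_smul]; abel
  have hcm (k : ℕ) (h : hc • ha ^ k • z = ξ ^ (i + k) • ha ^ k • z) :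
      hc ^ m • ha ^ k • z = (ξ ^ m) ^ (i + k) • ha ^ k • z := by
    rw [pow_smul_of_smul_eq h, ← zpow_natCast, ← zpow_natCast, ← zpow_mul, ← zpow_mul, mul_comm]
  induction k with
  | zero =>
    have h0 : hc • ha ^ 0 • z = ξ ^ (i + (0 : ℕ)) • ha ^ 0 • z := by simpa using hz.c_smul
    refine ⟨h0, ?_, by simpa using hz.d_smul⟩
    rw [pow_succ', mul_smul, hda, hcm 0 h0, hz.b_smul_pow hξ, ← sub_smul, lowerCoeff_succ hq]
    simp [hz.d_smul, lowerCoeff, qInt, sub_smul]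
  | succ k ih =>
    obtain ⟨h1, h2, h3⟩ := ih (by omega)
    have hc' : hc • ha ^ (k + 1) • z = ξ ^ (i + (k + 1 : ℕ)) • ha ^ (k + 1) • z := by
      have hdn : hd ^ (n - 1) • ha ^ k • z = 0 := by
        rw [show n - 1 = (n - 1 - (k + 1)) + (k + 1) by omega, pow_add, mul_smul, h3, smul_zero]
      have h := congrArg (fun t : H 𝕜 m n ξ => t • ha ^ k • z) gen_a_mul_c
      simp only [add_smul, smul_assoc, mul_smul, hdn, smul_zero, add_zero, h1] at h
      rw [pow_succ', mul_smul, ← smul_inv_smul₀ hξ (hc • ha • ha ^ k • z), ← h, smul_comm ha,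
        smul_smul]
      congr 1
      rw [show i + ((k + 1 : ℕ) : ℤ) = 1 + (i + k) by push_cast; ring, zpow_add₀ hξ 1, zpow_one]
    refine ⟨hc', ?_, ?_⟩
    · rw [pow_succ' _ (k + 1), mul_smul, hda, hcm _ hc', hz.b_smul_pow hξ, h2, ← sub_smul,
        lowerCoeff_succ hq i β (k + 1), smul_comm ha, ← mul_smul ha, ← pow_succ', ← sub_smul]
    · rw [pow_succ, mul_smul, h2, smul_comm, h3, smul_zero]

theorem c_smul_pow (hz : IsHighestWeight m n ξ i β z) (hξ : ξ ≠ 0) {k : ℕ} (hk : k < n) :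
    hc • ha ^ k • z = ξ ^ (i + k) • ha ^ k • z :=
  (hz.c_smul_pow_and_d_smul_pow hξ k hk).1

theorem d_smul_pow_succ (hz : IsHighestWeight m n ξ i β z) (hξ : ξ ≠ 0) {k : ℕ} (hk : k < n) :
    hd • ha ^ (k + 1) • z = lowerCoeff (ξ ^ m) i β (k + 1) • ha ^ k • z :=
  (hz.c_smul_pow_and_d_smul_pow hξ k hk).2.1

theorem a_pow_n_smul (hz : IsHighestWeight m n ξ i β z) : ha ^ n • z = (β ^ n - 1) • z := by
  rw [gen_a_pow, sub_smul, pow_smul_of_smul_eq hz.b_smul, one_smul, sub_smul, one_smul]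

theorem pow_smul_ne_zero (hz : IsHighestWeight m n ξ i β z) (hξ : ξ ≠ 0) {t : ℕ} (ht : t ≤ n)
    (hμ : ∀ k, 0 < k → k < t → lowerCoeff (ξ ^ m) i β k ≠ 0) {k : ℕ} (hk : k < t) :
    ha ^ k • z ≠ 0 := by
  induction k with
  | zero => simpa using hz.ne_zero
  | succ k ih =>
    intro h
    have h1 := hz.d_smul_pow_succ hξ (k := k) (by omega)
    rw [h, smul_zero, eq_comm, smul_eq_zero] at h1
    exact h1.elim (hμ _ (by omega) hk) (ih (by omega))

/-- The span of `a^k • z` for `s ≤ k < t` is everything once it is a nonzero submodule. -/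
theorem span_eq_top [IsSimpleModule (H 𝕜 m n ξ) S] (hz : IsHighestWeight m n ξ i β z)
    (hξ : ξ ≠ 0) {s t : ℕ} (hst : s < t) (ht : t ≤ n) (hs0 : ha ^ s • z ≠ 0)
    (hs : s = 0 ∨ lowerCoeff (ξ ^ m) i β s = 0)
    (hat : ha ^ t • z ∈ Submodule.span 𝕜 ((fun k : ℕ => ha ^ k • z) '' Set.Ico s t)) :
    Submodule.span 𝕜 ((fun k : ℕ => ha ^ k • z) '' Set.Ico s t) = ⊤ := by
  set P := Submodule.span 𝕜 ((fun k : ℕ => ha ^ k • z) '' Set.Ico s t) with hP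
  have mem {k : ℕ} (h1 : s ≤ k) (h2 : k < t) : ha ^ k • z ∈ P :=
    Submodule.subset_span ⟨k, ⟨h1, h2⟩, rfl⟩
  have lift (g : H 𝕜 m n ξ) (hg : ∀ k, s ≤ k → k < t → g • ha ^ k • z ∈ P) :
      ∀ x ∈ P, g • x ∈ P := by
    intro x hx
    have : P ≤ P.comap (DistribSMul.toLinearMap 𝕜 S g) := by
      conv_lhs => rw [hP]
      rw [Submodule.span_le]
      rintro _ ⟨k, ⟨h1, h2⟩, rfl⟩
      exact hg k h1 h2
    exact this hx
  refine eq_top_of_gen_smul_mem P (fun j => lift _ fun k h1 h2 => ?_) (mem le_rfl hst) hs0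
  fin_cases j
  · change ha • ha ^ k • z ∈ P
    rw [← mul_smul, ← pow_succ']
    rcases (show k + 1 < t ∨ k + 1 = t by omega) with h | h
    · exact mem (by omega) h
    · rwa [h]
  · change hb • ha ^ k • z ∈ P
    rw [hz.b_smul_pow hξ]
    exact P.smul_mem _ (mem h1 h2)
  · change hc • ha ^ k • z ∈ P
    rw [hz.c_smul_pow hξ (by omega)]
    exact P.smul_mem _ (mem h1 h2)
  · change hd • ha ^ k • z ∈ P
    rcases k with _ | k
    · rw [pow_zero, one_smul, hz.d_smul]; exact P.zero_mem
    · rw [hz.d_smul_pow_succ hξ (by omega)]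
      rcases (show s ≤ k ∨ s = k + 1 by omega) with h | h
      · exact P.smul_mem _ (mem h (by omega))
      · rw [← h, hs.resolve_left (by omega), zero_smul]; exact P.zero_mem

theorem linearIndependent (hm : 0 < m) (hξ : IsPrimitiveRoot ξ (m * n))
    (hz : IsHighestWeight m n ξ i β z) {t : ℕ} (ht : t ≤ n)
    (h0 : ∀ k < t, ha ^ k • z ≠ 0) :
    LinearIndependent 𝕜 (fun k : Fin t => ha ^ (k : ℕ) • z) := by
  refine Module.End.eigenvectors_linearIndependent' (DistribSMul.toLinearMap 𝕜 S hc)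
    (fun k : Fin t => ξ ^ (i + (k : ℕ))) (fun k l h => ?_) _ fun k => ?_
  · exact Fin.ext (eq_of_zpow_add_eq hm hξ i (lt_of_lt_of_le k.2 ht) (lt_of_lt_of_le l.2 ht) h)
  · have hk : (k : ℕ) < n := lt_of_lt_of_le k.2 ht
    have hn : m * n ≠ 0 := (Nat.mul_pos hm (by omega)).ne'
    exact Module.End.hasEigenvector_iff.2 ⟨Module.End.mem_eigenspace_iff.2
      (hz.c_smul_pow (hξ.ne_zero hn) hk), h0 k k.2⟩

theorem not_mem_span (hm : 0 < m) (hξ : IsPrimitiveRoot ξ (m * n))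
    (hz : IsHighestWeight m n ξ i β z) {s : ℕ} (hs : 0 < s) (hn : 0 < n) :
    z ∉ Submodule.span 𝕜 ((fun k : ℕ => ha ^ k • z) '' Set.Ico s n) := by
  intro h
  have h0 : ξ ≠ 0 := hξ.ne_zero (Nat.mul_pos hm hn).ne'
  let f : Module.End 𝕜 S := DistribSMul.toLinearMap 𝕜 S hc
  have hle : Submodule.span 𝕜 ((fun k : ℕ => ha ^ k • z) '' Set.Ico s n) ≤
      ⨆ (γ : 𝕜) (_ : γ ≠ ξ ^ i), f.eigenspace γ := by
    rw [Submodule.span_le]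
    rintro _ ⟨k, ⟨hk1, hk2⟩, rfl⟩
    refine Submodule.mem_iSup_of_mem (ξ ^ (i + k)) (Submodule.mem_iSup_of_mem (fun he => ?_)
      (Module.End.mem_eigenspace_iff.2 (hz.c_smul_pow h0 hk2)))
    have := eq_of_zpow_add_eq hm hξ i (k := k) (l := 0) hk2 hn (by simpa using he)
    omega
  exact hz.ne_zero (Submodule.disjoint_def.1 (f.eigenspaces_iSupIndep (ξ ^ i)) z
    (Module.End.mem_eigenspace_iff.2 hz.c_smul) (hle h))

theorem isZrep [IsSimpleModule (H 𝕜 m n ξ) S] (hm : 0 < m) (hn : 0 < n)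
    (hξ : IsPrimitiveRoot ξ (m * n)) {j : ℤ} (hz : IsHighestWeight m n ξ i (ξ ^ j) z)
    (hμ : ∀ k, 0 < k → k < n → lowerCoeff (ξ ^ m) i (ξ ^ j) k ≠ 0) :
    IsZrep 𝕜 m n ξ i j S := by
  have h0 : ξ ≠ 0 := hξ.ne_zero (Nat.mul_pos hm hn).ne'
  refine ⟨z, hz.d_smul, hz.b_smul, hz.c_smul, hz.linearIndependent hm hξ le_rfl fun k hk =>
    hz.pow_smul_ne_zero h0 le_rfl hμ hk, ?_⟩
  rw [range_fin_eq_image_Ico fun k : ℕ => ha ^ k • z]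
  refine hz.span_eq_top h0 hn le_rfl (by simpa using hz.ne_zero) (Or.inl rfl) ?_
  rw [hz.a_pow_n_smul]
  exact Submodule.smul_mem _ _ (Submodule.subset_span ⟨0, ⟨le_rfl, hn⟩, by simp⟩)

theorem a_pow_smul_eq_zero [IsSimpleModule (H 𝕜 m n ξ) S] (hm : 0 < m)
    (hξ : IsPrimitiveRoot ξ (m * n)) (hz : IsHighestWeight m n ξ i β z) (hβ : β ^ n = 1)
    {l : ℕ} (hl0 : 0 < l) (hl : l < n) (hμ : lowerCoeff (ξ ^ m) i β l = 0) :
    ha ^ l • z = 0 := by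
  by_contra hne
  have h0 : ξ ≠ 0 := hξ.ne_zero (Nat.mul_pos hm (by omega)).ne'
  refine hz.not_mem_span hm hξ hl0 (by omega) ?_
  rw [hz.span_eq_top h0 hl le_rfl hne (Or.inr hμ) (by simp [hz.a_pow_n_smul, hβ])]
  trivial

theorem exists_isMrep [IsSimpleModule (H 𝕜 m n ξ) S] (hm : 0 < m)
    (hξ : IsPrimitiveRoot ξ (m * n)) {l : ℕ} (hl0 : 0 < l) (hl : l < n)
    (hz : IsHighestWeight m n ξ i ((ξ ^ m) ^ (i + (l : ℤ) - 1)) z) :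
    ∃ mv : Fin l → S, IsMrep 𝕜 m n ξ l i mv := by
  have hmn : m * n ≠ 0 := (Nat.mul_pos hm (by omega)).ne'
  have h0 : ξ ≠ 0 := hξ.ne_zero hmn
  have hq : IsPrimitiveRoot (ξ ^ m) n := hξ.pow (Nat.pos_of_ne_zero hmn) rfl
  have hq0 : ξ ^ m ≠ 0 := pow_ne_zero _ h0
  set β := (ξ ^ m) ^ (i + (l : ℤ) - 1) with hβ
  have hβn : β ^ n = 1 := by
    rw [hβ, ← zpow_natCast, ← zpow_mul, mul_comm, zpow_mul, zpow_natCast, hq.pow_eq_one, one_zpow]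
  have hal : ha ^ l • z = 0 := hz.a_pow_smul_eq_zero hm hξ hβn hl0 hl
    ((lowerCoeff_eq_zero_iff hq i β hl0 hl).2 rfl)
  have hμ : ∀ k, 0 < k → k < l → lowerCoeff (ξ ^ m) i β k ≠ 0 := by
    intro k hk0 hk h
    rw [lowerCoeff_eq_zero_iff hq i β hk0 (by omega), hβ,
      show i + (l : ℤ) - 1 = (i - 1) + l by ring, show i + (k : ℤ) - 1 = (i - 1) + k by ring,
      zpow_add₀ hq0, zpow_add₀ hq0, zpow_natCast, zpow_natCast] at h
    have := hq.pow_inj hl (by omega) (mul_left_cancel₀ (zpow_ne_zero _ hq0) h)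
    omega
  have hne : ∀ k < l, ha ^ k • z ≠ 0 := fun k hk => hz.pow_smul_ne_zero h0 hl.le hμ hk
  have hli := hz.linearIndependent hm hξ hl.le hne
  have hsp := hz.span_eq_top h0 hl0 hl.le (by simpa using hz.ne_zero) (Or.inl rfl)
    (by rw [hal]; exact Submodule.zero_mem _)
  rw [← range_fin_eq_image_Ico] at hsp
  let w : ℕ → 𝕜 := fun k => ∏ j ∈ Finset.range k, lowerCoeff (ξ ^ m) i β (j + 1)
  have hw (k : ℕ) (hk : k < l) : w k ≠ 0 :=
    Finset.prod_ne_zero_iff.2 fun j hj => hμ _ (by omega) (by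
      have := Finset.mem_range.1 hj; omega)
  have hws (k : ℕ) : w (k + 1) = w k * lowerCoeff (ξ ^ m) i β (k + 1) :=
    Finset.prod_range_succ _ _
  let u : Fin l → 𝕜ˣ := fun k => (Units.mk0 (w k) (hw k k.2))⁻¹
  have hmv (k : Fin l) : (u • fun k : Fin l => ha ^ (k : ℕ) • z) k = (w k)⁻¹ • ha ^ (k : ℕ) • z :=
    rfl
  refine ⟨u • fun k : Fin l => ha ^ (k : ℕ) • z, hli.units_smul u, ?_, ?_, ?_, ?_, ?_, ?_, ?_⟩
  · exact Module.Basis.units_smul_span_eq_top hsp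
  · intro j hj
    simp only [hmv]
    rw [smul_comm, ← mul_smul ha, ← pow_succ', smul_smul, hws, alph, if_neg (by omega), mul_inv]
    have h1 := hμ (j + 1) (by omega) hj
    congr 1
    have e : qInt 𝕜 (ξ ^ m) (j + 1) * ((ξ ^ m) ^ i - (ξ ^ m) ^ (i + (l : ℤ) - ((j + 1 : ℕ) : ℤ)))
        = lowerCoeff (ξ ^ m) i β (j + 1) := by
      rw [lowerCoeff, hβ, ← zpow_add₀ hq0]; congr 3; ring
    rw [e]
    field_simp
  · intro j hj hjl
    simp only [hmv]
    rw [smul_comm, ← mul_smul ha, ← pow_succ', hjl, hal, smul_zero]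
  · intro j
    rw [hmv, smul_comm, hz.b_smul_pow h0, hβ, ← zpow_add₀ hq0, smul_comm]
    congr 2; ring
  · intro j
    rw [hmv, smul_comm, hz.c_smul_pow h0 (by omega), smul_comm]
  · intro j hj
    simp only [hmv]
    rw [smul_comm, hz.d_smul_pow_succ h0 (by omega), smul_smul, hws, mul_inv,
      inv_mul_cancel_right₀ (hμ (j + 1) (by omega) hj)]
  · intro hl
    rw [hmv, smul_comm]
    simp [hz.d_smul]

end IsHighestWeight

theorem exists_smul_eq_of_gen_d_smul_eq_zero {l : ℕ} {e : Fin (l + 1) → S} {μ : Fin l → 𝕜}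
    (hli : LinearIndependent 𝕜 e) (hsp : Submodule.span 𝕜 (Set.range e) = ⊤)
    (h0 : hd • e 0 = 0) (hs : ∀ k : Fin l, hd • e k.succ = μ k • e k.castSucc)
    (hμ : ∀ k, μ k ≠ 0) {x : S} (hx : hd • x = 0) : ∃ r : 𝕜, x = r • e 0 := by
  obtain ⟨r, rfl⟩ := (Submodule.mem_span_range_iff_exists_fun 𝕜).1
    (hsp ▸ Submodule.mem_top : x ∈ Submodule.span 𝕜 (Set.range e))
  have h : ∑ k : Fin l, (r k.succ * μ k) • e k.castSucc = 0 := by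
    rw [← hx, Finset.smul_sum, Fin.sum_univ_succ, smul_comm, h0, smul_zero, zero_add]
    refine Finset.sum_congr rfl fun k _ => ?_
    rw [smul_comm, hs, smul_smul]
  have hr (k : Fin l) : r k.succ = 0 :=
    (mul_eq_zero.1 (Fintype.linearIndependent_iff.1
      (hli.comp _ (Fin.castSucc_injective l)) _ h k)).resolve_right (hμ k)
  exact ⟨r 0, by simp [Fin.sum_univ_succ, hr]⟩

/-- Highest weights are determined when the kernel of `d` is a line. -/
theorem IsHighestWeight.weight_eq {i i' : ℤ} {β β' : 𝕜} {z z' : S}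
    (hz : IsHighestWeight m n ξ i β z) (hz' : IsHighestWeight m n ξ i' β' z')
    (hker : ∃ r : 𝕜, z' = r • z) : ξ ^ i' = ξ ^ i ∧ β' = β := by
  obtain ⟨r, rfl⟩ := hker
  refine ⟨smul_left_injective 𝕜 hz'.ne_zero ?_, smul_left_injective 𝕜 hz'.ne_zero ?_⟩
  · change ξ ^ i' • r • z = ξ ^ i • r • z
    rw [← hz'.c_smul, smul_comm, hz.c_smul, smul_comm]
  · change β' • r • z = β • r • z
    rw [← hz'.b_smul, smul_comm, hz.b_smul, smul_comm]

theorem IsZrep.finrank_eq {i j : ℤ} (h : IsZrep 𝕜 m n ξ i j S) : Module.finrank 𝕜 S = n := by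
  obtain ⟨z, -, -, -, hli, hsp⟩ := h
  simpa using Module.finrank_eq_card_basis (Module.Basis.mk hli hsp.ge)

theorem IsMrep.exists_isHighestWeight {l : ℕ} (hl : 0 < l) {i : ℤ} {mv : Fin l → S}
    (h : IsMrep 𝕜 m n ξ l i mv) :
    ∃ z : S, IsHighestWeight m n ξ i ((ξ ^ m) ^ (i + (l : ℤ) - 1)) z ∧
      ∀ x : S, hd • x = 0 → ∃ r : 𝕜, x = r • z := by
  obtain ⟨hli, hsp, -, -, hb', hc', hds, hd0⟩ := h
  obtain _ | l := l
  · omega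
  refine ⟨mv 0, ⟨hli.ne_zero 0, hd0 hl, by simpa using hb' 0, by simpa using hc' 0⟩, fun x hx => ?_⟩
  exact exists_smul_eq_of_gen_d_smul_eq_zero hli hsp (hd0 hl) (μ := fun _ => 1)
    (fun k => (hds k (by omega)).trans (one_smul 𝕜 _).symm) (fun _ => one_ne_zero) hx

theorem IsZrep.exists_isHighestWeight (hn : 0 < n) (hξ : ξ ≠ 0) {i j : ℤ}
    (hμ : ∀ k, 0 < k → k < n → lowerCoeff (ξ ^ m) i (ξ ^ j) k ≠ 0)
    (h : IsZrep 𝕜 m n ξ i j S) :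
    ∃ z : S, IsHighestWeight m n ξ i (ξ ^ j) z ∧
      ∀ x : S, hd • x = 0 → ∃ r : 𝕜, x = r • z := by
  obtain ⟨z, hd', hb', hc', hli, hsp⟩ := h
  have hz : IsHighestWeight m n ξ i (ξ ^ j) z :=
    ⟨by simpa using hli.ne_zero ⟨0, hn⟩, hd', hb', hc'⟩
  have hds (k : ℕ) (hk : k < n) := hz.d_smul_pow_succ hξ hk
  obtain ⟨l, hl⟩ : ∃ l, n = l + 1 := ⟨n - 1, by omega⟩
  refine ⟨z, hz, fun x hx => ?_⟩
  have key (t : ℕ) (ht : t = l + 1)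
      (hli : LinearIndependent 𝕜 (fun k : Fin t => (ha ^ (k : ℕ)) • z))
      (hsp : Submodule.span 𝕜 (Set.range fun k : Fin t => (ha ^ (k : ℕ)) • z) = ⊤) :
      ∃ r : 𝕜, x = r • z := by
    subst ht
    obtain ⟨r, hr⟩ := exists_smul_eq_of_gen_d_smul_eq_zero hli hsp (by simpa using hd')
      (μ := fun k => lowerCoeff (ξ ^ m) i (ξ ^ j) (k + 1)) (fun k => hds k (by omega))
      (fun k => hμ _ (by omega) (by omega)) hx
    exact ⟨r, by simpa using hr⟩
  exact key n hl hli hsp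

theorem exists_eigenvector_of_commute {V : Type*} [AddCommGroup V] [Module 𝕜 V]
    [IsAlgClosed 𝕜] [FiniteDimensional 𝕜 V] [Nontrivial V] {f g : Module.End 𝕜 V}
    (hfg : ∀ x, f (g x) = g (f x)) :
    ∃ (β γ : 𝕜) (z : V), z ≠ 0 ∧ f z = β • z ∧ g z = γ • z := by
  obtain ⟨γ, hγ⟩ := Module.End.exists_eigenvalue g
  have hmaps : ∀ x ∈ g.eigenspace γ, f x ∈ g.eigenspace γ := by
    intro x hx
    rw [Module.End.mem_eigenspace_iff] at hx ⊢
    rw [← hfg, hx, map_smul]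
  have : Nontrivial (g.eigenspace γ) := Submodule.nontrivial_iff_ne_bot.2 hγ
  obtain ⟨β, hβ⟩ := Module.End.exists_eigenvalue (f.restrict hmaps)
  obtain ⟨z, hz⟩ := hβ.exists_hasEigenvector
  refine ⟨β, γ, z, fun h => hz.2 (Subtype.ext h), ?_, Module.End.mem_eigenspace_iff.1 z.2⟩
  exact congrArg Subtype.val hz.apply_eq_smul

theorem exists_isHighestWeight [IsAlgClosed 𝕜] [FiniteDimensional 𝕜 S] [Nontrivial S]
    (hmn : 0 < m * n) (hξ : IsPrimitiveRoot ξ (m * n)) :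
    ∃ i j : ℕ, i < m * n ∧ j < m * n ∧ ∃ z : S,
      IsHighestWeight m n ξ (i : ℤ) (ξ ^ (j : ℤ)) z := by
  let D : Submodule 𝕜 S := dKer 𝕜 m n ξ S
  have : Nontrivial D := by
    rw [Submodule.nontrivial_iff_ne_bot]
    intro hD
    have hinj (x : S) (hx : hd • x = 0) : x = 0 := by
      have : x ∈ D := hx
      rwa [hD, Submodule.mem_bot] at this
    have hpow (k : ℕ) (x : S) (hx : hd ^ k • x = 0) : x = 0 := by
      induction k with
      | zero => simpa using hx
      | succ k ih => exact ih (hinj _ (by rwa [← mul_smul, ← pow_succ']))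
    obtain ⟨x, hx⟩ := exists_ne (0 : S)
    exact hx (hpow n x (by rw [gen_d_pow, zero_smul]))
  have hbD : ∀ x ∈ D, DistribSMul.toLinearMap 𝕜 S hb x ∈ D := by
    intro x hx
    have hx : hd • x = 0 := hx
    have h : ξ ^ m • hd • hb • x = 0 := by
      rw [← mul_smul hd, ← smul_assoc, ← gen_b_mul_d, mul_smul, hx, smul_zero]
    exact (smul_eq_zero.1 h).resolve_left (pow_ne_zero _ (hξ.ne_zero hmn.ne'))
  have hcD : ∀ x ∈ D, DistribSMul.toLinearMap 𝕜 S hc x ∈ D := by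
    intro x hx
    have hx : hd • x = 0 := hx
    change hd • hc • x = 0
    rw [← mul_smul, gen_d_mul_c, smul_assoc, mul_smul, hx, smul_zero, smul_zero]
  obtain ⟨β, γ, ⟨z, hzD⟩, hz0, hzb, hzc⟩ := exists_eigenvector_of_commute
    (f := (DistribSMul.toLinearMap 𝕜 S hb).restrict hbD)
    (g := (DistribSMul.toLinearMap 𝕜 S hc).restrict hcD) (fun x => Subtype.ext (by
      change hb • hc • (x : S) = hc • hb • (x : S)
      rw [← mul_smul, gen_b_mul_c, mul_smul]))
  have hz0 : z ≠ 0 := fun h => hz0 (Subtype.ext h)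
  have hzb : hb • z = β • z := congrArg Subtype.val hzb
  have hzc : hc • z = γ • z := congrArg Subtype.val hzc
  have root {h : H 𝕜 m n ξ} {η : 𝕜} (hh : h ^ (m * n) = 1) (hη : h • z = η • z) :
      η ^ (m * n) = 1 := by
    refine smul_left_injective 𝕜 hz0 ?_
    change η ^ (m * n) • z = (1 : 𝕜) • z
    rw [← pow_smul_of_smul_eq hη, hh, one_smul, one_smul]
  have : NeZero (m * n) := ⟨hmn.ne'⟩
  obtain ⟨j, hj, rfl⟩ := hξ.eq_pow_of_pow_eq_one (root gen_b_pow hzb)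
  obtain ⟨i, hi, rfl⟩ := hξ.eq_pow_of_pow_eq_one (root gen_c_pow hzc)
  exact ⟨i, j, hi, hj, z, hz0, hzD, by simpa using hzb, by simpa using hzc⟩

end HighestWeight

/-- Proposition 3.3: `{M(l,i), Z(λ_{i'j'}) | 1 ≤ l ≤ n-1, i ∈ ℤ_{mn},
(i',j') ∈ I_0}` is a representative set of isomorphism classes of finite dimensional simple
`H_{mn}(ξ)`-modules: every finite dimensional simple module matches exactly one index. -/
theorem statement5 (𝕜 : Type) [Field 𝕜] [IsAlgClosed 𝕜] (m n : ℕ) (hm : 1 < m) (hn : 1 < n)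
    (ξ : 𝕜) (hξ : IsPrimitiveRoot ξ (m * n))
    (S : Type) [AddCommGroup S] [Module 𝕜 S] [Module (H 𝕜 m n ξ) S]
    [IsScalarTower 𝕜 (H 𝕜 m n ξ) S] [FiniteDimensional 𝕜 S]
    (hS : IsSimpleModule (H 𝕜 m n ξ) S) :
    ∃! x : {p : ℕ × ℕ // 1 ≤ p.1 ∧ p.1 ≤ n - 1 ∧ p.2 < m * n} ⊕
        {p : ℕ × ℕ // p.1 < m * n ∧ p.2 < m * n ∧
          ∀ k : ℕ, k ≤ n - 2 → (ξ ^ m) ^ ((p.1 : ℤ) + k) ≠ ξ ^ (p.2 : ℤ)},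
      Sum.elim
        (fun y : {p : ℕ × ℕ // 1 ≤ p.1 ∧ p.1 ≤ n - 1 ∧ p.2 < m * n} =>
          ∃ mv : Fin y.1.1 → S, IsMrep 𝕜 m n ξ y.1.1 (y.1.2 : ℤ) mv)
        (fun y : {p : ℕ × ℕ // p.1 < m * n ∧ p.2 < m * n ∧
            ∀ k : ℕ, k ≤ n - 2 → (ξ ^ m) ^ ((p.1 : ℤ) + k) ≠ ξ ^ (p.2 : ℤ)} =>
          IsZrep 𝕜 m n ξ (y.1.1 : ℤ) (y.1.2 : ℤ) S) x := by
  have := hS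
  have : Nontrivial S := IsSimpleModule.nontrivial (H 𝕜 m n ξ) S
  have hm0 : 0 < m := by omega
  have hn0 : 0 < n := by omega
  have hmn : 0 < m * n := Nat.mul_pos hm0 hn0
  have h0 : ξ ≠ 0 := hξ.ne_zero hmn.ne'
  have hq : IsPrimitiveRoot (ξ ^ m) n := hξ.pow hmn rfl
  have hI0 {i j : ℕ} (h : ∀ k : ℕ, k ≤ n - 2 → (ξ ^ m) ^ ((i : ℤ) + k) ≠ ξ ^ (j : ℤ)) (k : ℕ)
      (hk0 : 0 < k) (hk : k < n) : lowerCoeff (ξ ^ m) (i : ℤ) (ξ ^ (j : ℤ)) k ≠ 0 := by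
    rw [Ne, lowerCoeff_eq_zero_iff hq _ _ hk0 hk]
    intro he
    refine h (k - 1) (by omega) (he.trans ?_).symm
    congr 1; omega
  have inj {i i' : ℕ} (hi : i < m * n) (hi' : i' < m * n)
      (h : ξ ^ (i : ℤ) = ξ ^ (i' : ℤ)) : i = i' :=
    hξ.pow_inj hi hi' (by simpa using h)
  refine existsUnique_of_exists_of_unique ?_ ?_
  · obtain ⟨i, j, hi, hj, z, hz⟩ := exists_isHighestWeight (S := S) hmn hξ
    by_cases h : ∀ k : ℕ, k ≤ n - 2 → (ξ ^ m) ^ ((i : ℤ) + k) ≠ ξ ^ (j : ℤ)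
    · exact ⟨Sum.inr ⟨(i, j), hi, hj, h⟩, hz.isZrep hm0 hn0 hξ (hI0 h)⟩
    · push Not at h
      obtain ⟨k, hk, he⟩ := h
      refine ⟨Sum.inl ⟨(k + 1, i), by simp, by change k + 1 ≤ n - 1; omega, hi⟩, ?_⟩
      refine IsHighestWeight.exists_isMrep hm0 hξ (l := k + 1) (z := z) (by omega) (by omega) ?_
      rwa [show (i : ℤ) + ((k + 1 : ℕ) : ℤ) - 1 = i + k by push_cast; ring, he]
  · rintro (⟨⟨l, i⟩, hl1, hl2, hi⟩ | ⟨⟨i, j⟩, hi, hj, hij⟩)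
      (⟨⟨l', i'⟩, hl1', hl2', hi'⟩ | ⟨⟨i', j'⟩, hi', hj', hij'⟩) hx hy
    · obtain ⟨mv, hx⟩ := hx
      obtain ⟨mv', hy⟩ := hy
      dsimp only at *
      obtain rfl : l = l' := hx.finrank_eq.symm.trans hy.finrank_eq
      obtain ⟨z, hz, hker⟩ := hx.exists_isHighestWeight hl1
      obtain ⟨z', hz', -⟩ := hy.exists_isHighestWeight hl1
      obtain rfl := inj hi' hi (hz.weight_eq hz' (hker z' hz'.d_smul)).1
      rfl
    · obtain ⟨mv, hx⟩ := hx
      have := hx.finrank_eq.symm.trans (IsZrep.finrank_eq hy)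
      dsimp only at *
      omega
    · obtain ⟨mv, hy⟩ := hy
      have := hy.finrank_eq.symm.trans (IsZrep.finrank_eq hx)
      dsimp only at *
      omega
    · obtain ⟨z, hz, hker⟩ := IsZrep.exists_isHighestWeight hn0 h0 (hI0 hij) hx
      obtain ⟨z', hz', -⟩ := IsZrep.exists_isHighestWeight hn0 h0 (hI0 hij') hy
      obtain ⟨e1, e2⟩ := hz.weight_eq hz' (hker z' hz'.d_smul)
      dsimp only at *
      obtain rfl := inj hi' hi e1
      obtain rfl := inj hj' hj e2
      rfl

end Radford
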